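/- The class PG_δ ∩ PF_σ of subsets of ℝ_Γ is a Boolean algebra containing all prime-open and all prime-closed subsets of ℝ_Γ. -/

import Mathlib

/-!
Abstract setting for real Mazurkiewicz traces: `T` is the set ℝ of real
traces with the prefix partial order, `P : Set T` is the set 𝒫 of prime
traces, `cone p` is `pℝ = {t : p ≤ t}`.
-/

namespace MzTrace

variable {T : Type} [PartialOrder T]

/-- `cone p` models `pℝ`, the set of traces having `p` as a prefix. -/
def cone (p : T) : Set T := Set.Ici p

/-- A set of traces is prime-open (w.r.t. the set `P` of prime traces)
if it is a union `⋃ {pℝ : p ∈ U}` for some `U ⊆ P`. -/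
def PrimeOpen (P : Set T) (L : Set T) : Prop := ∃ U ⊆ P, L = ⋃ p ∈ U, cone p

/-- A set is prime-closed if its complement is prime-open. -/
def PrimeClosed (P : Set T) (L : Set T) : Prop := PrimeOpen P Lᶜ

/-- The prime closure of `L`: the intersection of all prime-closed supersets. -/
def primeClosure (P : Set T) (L : Set T) : Set T := ⋂₀ {K | PrimeClosed P K ∧ L ⊆ K}

/-- A set `C` of traces is coherent if it has a common upper bound (a trace
`t` with `C ⊆ pref(t)`). -/
def Coherent (C : Set T) : Prop := BddAbove C

/-- `primePref P L` is `𝒫(L)`, the set of prime prefixes of elements of `L`. -/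
def primePref (P : Set T) (L : Set T) : Set T := {p ∈ P | ∃ t ∈ L, p ≤ t}

/-- `L` is locally monitorable: for every prime `s` there is a prime `t`
with `{s,t}` coherent (i.e. `s ≤ tℝ`) and `tℝ ⊆ L` or `tℝ ⊆ Lᶜ`. -/
def LocallyMonitorable (P : Set T) (L : Set T) : Prop :=
  ∀ s ∈ P, ∃ t ∈ P, Coherent {s, t} ∧ (cone t ⊆ L ∨ cone t ⊆ Lᶜ)

end MzTrace

namespace MzTrace

variable {T : Type} [PartialOrder T]

/-- Prime-open relative to `R = ℝ_Γ`: a set of the form `⋃{pℝ : p ∈ U} ∩ R`. -/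
def PrimeOpenIn (P R L : Set T) : Prop := ∃ U ⊆ P, L = (⋃ p ∈ U, cone p) ∩ R

/-- Prime-closed relative to `R`: the complement in `R` is prime-open in `R`. -/
def PrimeClosedIn (P R L : Set T) : Prop := PrimeOpenIn P R (R \ L)

/-- `PG_δ`: countable intersections of prime-open subsets of `R`. -/
def PGdelta (P R L : Set T) : Prop :=
  ∃ U : ℕ → Set T, (∀ n, PrimeOpenIn P R (U n)) ∧ L = ⋂ n, U n

/-- `PF_σ`: complements in `R` of `PG_δ` sets. -/
def PFsigma (P R L : Set T) : Prop := PGdelta P R (R \ L)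

end MzTrace

namespace MzTrace

variable {T : Type} [PartialOrder T] {P R L K : Set T}

lemma PrimeOpenIn.subset (h : PrimeOpenIn P R L) : L ⊆ R := by
  obtain ⟨U, -, rfl⟩ := h
  exact Set.inter_subset_right

lemma PrimeOpenIn.union (hL : PrimeOpenIn P R L) (hK : PrimeOpenIn P R K) :
    PrimeOpenIn P R (L ∪ K) := by
  obtain ⟨U, hU, rfl⟩ := hL
  obtain ⟨V, hV, rfl⟩ := hK
  exact ⟨U ∪ V, Set.union_subset hU hV, by rw [Set.biUnion_union, Set.union_inter_distrib_right]⟩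

lemma PrimeOpenIn.pgdelta (h : PrimeOpenIn P R L) : PGdelta P R L :=
  ⟨fun _ => L, fun _ => h, (Set.iInter_const L).symm⟩

lemma PGdelta.subset (h : PGdelta P R L) : L ⊆ R := by
  obtain ⟨U, hU, rfl⟩ := h
  exact (Set.iInter_subset U 0).trans (hU 0).subset

lemma PGdelta.of_iInter {ι : Type*} [Countable ι] [Nonempty ι] {U : ι → Set T}
    (hU : ∀ i, PrimeOpenIn P R (U i)) : PGdelta P R (⋂ i, U i) := by
  obtain ⟨f, hf⟩ := exists_surjective_nat ι
  exact ⟨fun n => U (f n), fun n => hU (f n), (hf.iInter_comp U).symm⟩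

lemma PGdelta.union (hL : PGdelta P R L) (hK : PGdelta P R K) : PGdelta P R (L ∪ K) := by
  obtain ⟨U, hU, rfl⟩ := hL
  obtain ⟨V, hV, rfl⟩ := hK
  have h : (⋂ n, U n) ∪ ⋂ m, V m = ⋂ i : ℕ × ℕ, U i.1 ∪ V i.2 := by
    ext x
    simp only [Set.mem_union, Set.mem_iInter, Prod.forall, forall_or_left, forall_or_right]
  rw [h]
  exact PGdelta.of_iInter fun i => (hU i.1).union (hV i.2)

lemma PGdelta.inter (hL : PGdelta P R L) (hK : PGdelta P R K) : PGdelta P R (L ∩ K) := by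
  obtain ⟨U, hU, rfl⟩ := hL
  obtain ⟨V, hV, rfl⟩ := hK
  have h : (⋂ n, U n) ∩ ⋂ m, V m = ⋂ i, Sum.elim U V i := by
    simp only [Set.iInter_sum, Sum.elim_inl, Sum.elim_inr]
  rw [h]
  exact PGdelta.of_iInter (by rintro (n | n) <;> simp [hU, hV])

/-- A prime-closed set is the intersection, over `α ∈ Γ` and `k`, of the prime-open sets generated
by those of its prime prefixes that have length at least `k` and a maximal event in `α`. -/
lemma PrimeClosedIn.pgdelta {Proc : Type} [Finite Proc] {Γ : Set Proc} (hΓ : Γ.Nonempty)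
    {len : T → ℕ} {maxdom : T → Set Proc}
    (hdeep : ∀ x ∈ R, ∀ α ∈ Γ, ∀ k : ℕ, ∃ p ∈ P, p ≤ x ∧ k ≤ len p ∧ α ∈ maxdom p)
    (hdom : ∀ x ∈ R, ∀ u ∈ P, u ≤ x →
      ∀ p : Proc → ℕ → T,
        (∀ α ∈ Γ, ∀ k : ℕ, p α k ∈ P ∧ p α k ≤ x ∧ k ≤ len (p α k) ∧ α ∈ maxdom (p α k)) →
        ∃ α ∈ Γ, ∃ k : ℕ, u ≤ p α k)
    (hLR : L ⊆ R) (hL : PrimeClosedIn P R L) : PGdelta P R L := by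
  have : Nonempty Γ := hΓ.to_subtype
  let V : Γ × ℕ → Set T := fun i =>
    {p ∈ primePref P L | i.2 ≤ len p ∧ (i.1 : Proc) ∈ maxdom p}
  have hV : L = ⋂ i, (⋃ p ∈ V i, cone p) ∩ R := by
    apply Set.Subset.antisymm
    · refine fun x hx => Set.mem_iInter.2 fun i => ⟨?_, hLR hx⟩
      obtain ⟨p, hp, hpx, hlen, hmax⟩ := hdeep x (hLR hx) i.1 i.1.2 i.2
      exact Set.mem_biUnion (show p ∈ V i from ⟨⟨hp, x, hx, hpx⟩, hlen, hmax⟩) hpx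
    · intro x hx
      rw [Set.mem_iInter] at hx
      have hxR : x ∈ R := (hx (Classical.arbitrary _)).2
      by_contra hxL
      obtain ⟨U, hU, hUL⟩ := hL
      have hxU : x ∈ (⋃ p ∈ U, cone p) ∩ R := hUL ▸ ⟨hxR, hxL⟩
      obtain ⟨u, huU, hux⟩ := Set.mem_iUnion₂.1 hxU.1
      have hpref : ∀ α k, ∃ p, α ∈ Γ →
          p ∈ primePref P L ∧ p ≤ x ∧ k ≤ len p ∧ α ∈ maxdom p := by
        intro α k
        by_cases hα : α ∈ Γ
        · obtain ⟨p, ⟨hp, hlen, hmax⟩, hpx⟩ := Set.mem_iUnion₂.1 (hx (⟨α, hα⟩, k)).1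
          exact ⟨p, fun _ => ⟨hp, hpx, hlen, hmax⟩⟩
        · exact ⟨x, fun h => absurd h hα⟩
      choose p hp using hpref
      obtain ⟨α, hα, k, huk⟩ := hdom x hxR u (hU huU) hux p fun α hα k =>
        ⟨(hp α k hα).1.1, (hp α k hα).2⟩
      obtain ⟨-, y, hyL, hpy⟩ := (hp α k hα).1
      have hy : y ∈ R \ L := hUL ▸ ⟨Set.mem_biUnion huU (huk.trans hpy), hLR hyL⟩
      exact hy.2 hyL
  rw [hV]
  exact PGdelta.of_iInter fun i => ⟨V i, fun p hp => hp.1.1, rfl⟩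

end MzTrace

namespace MzTrace

variable {T : Type} [PartialOrder T]

/-- Theorem thm:main (1): `PG_δ ∩ PF_σ` is a Boolean algebra
of subsets of `ℝ_Γ` containing all prime-open and all prime-closed subsets of
`ℝ_Γ`: it contains the prime-open and prime-closed sets, and is closed under
finite union, finite intersection and complement (in `ℝ_Γ`).

The hypotheses `hdeep`, `hdom` are the properties of `Γ`-infinite traces
(lengths `len`, maximal-event domains `maxdom`) used to show that
prime-closed subsets of `ℝ_Γ` are `PG_δ` (Lemma lem:pa). -/
theorem PGdelta_inter_PFsigma_booleanAlgebra {Proc : Type} [Finite Proc]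
    (Γ : Set Proc) (hΓ : Γ.Nonempty)
    (P RΓ : Set T) (len : T → ℕ) (maxdom : T → Set Proc)
    (hdeep : ∀ x ∈ RΓ, ∀ α ∈ Γ, ∀ k : ℕ, ∃ p ∈ P, p ≤ x ∧ k ≤ len p ∧ α ∈ maxdom p)
    (hdom : ∀ x ∈ RΓ, ∀ u ∈ P, u ≤ x →
      ∀ p : Proc → ℕ → T,
        (∀ α ∈ Γ, ∀ k : ℕ, p α k ∈ P ∧ p α k ≤ x ∧ k ≤ len (p α k) ∧ α ∈ maxdom (p α k)) →
        ∃ α ∈ Γ, ∃ k : ℕ, u ≤ p α k) :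
    (∀ L ⊆ RΓ, PrimeOpenIn P RΓ L → PGdelta P RΓ L ∧ PFsigma P RΓ L) ∧
    (∀ L ⊆ RΓ, PrimeClosedIn P RΓ L → PGdelta P RΓ L ∧ PFsigma P RΓ L) ∧
    (∀ L K : Set T,
        PGdelta P RΓ L ∧ PFsigma P RΓ L → PGdelta P RΓ K ∧ PFsigma P RΓ K →
        (PGdelta P RΓ (L ∪ K) ∧ PFsigma P RΓ (L ∪ K)) ∧
        (PGdelta P RΓ (L ∩ K) ∧ PFsigma P RΓ (L ∩ K))) ∧
    (∀ L : Set T, PGdelta P RΓ L ∧ PFsigma P RΓ L →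
        PGdelta P RΓ (RΓ \ L) ∧ PFsigma P RΓ (RΓ \ L)) := by
  refine ⟨fun L hL h => ⟨h.pgdelta, ?_⟩, fun L hL h => ⟨h.pgdelta hΓ hdeep hdom hL, ?_⟩,
    fun L K hL hK => ⟨⟨hL.1.union hK.1, ?_⟩, hL.1.inter hK.1, ?_⟩, fun L hL => ⟨hL.2, ?_⟩⟩
  · have hc : PrimeClosedIn P RΓ (RΓ \ L) := by
      rwa [PrimeClosedIn, Set.sdiff_sdiff_cancel_left hL]
    exact hc.pgdelta hΓ hdeep hdom Set.sdiff_subset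
  · exact PrimeOpenIn.pgdelta h
  · rw [PFsigma, ← Set.sdiff_inter_sdiff]
    exact PGdelta.inter hL.2 hK.2
  · rw [PFsigma, Set.sdiff_inter]
    exact PGdelta.union hL.2 hK.2
  · rw [PFsigma, Set.sdiff_sdiff_cancel_left hL.1.subset]
    exact hL.1


end MzTrace
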